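/- Let A be a unital C*-algebra with n-comparison (in the sense of Winter) for some integer n ≥ 0, and let p ∈ A be a nonzero projection. Then the unital hereditary C*-subalgebra pAp has n-comparison. -/

import Mathlib

open Filter Topology Matrix

/-- Cuntz subequivalence for matrices over a topological *-ring. -/
def MatCuntzLE {R : Type} [NonUnitalRing R] [StarRing R] [TopologicalSpace R]
    {ι κ : Type} [Fintype ι] [Fintype κ] (a : Matrix ι ι R) (b : Matrix κ κ R) : Prop :=
  ∃ v : ℕ → Matrix ι κ R,
    Filter.Tendsto (fun k => v k * b * (v k)ᴴ) Filter.atTop (nhds a)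

/-- Positivity of a matrix over a C*-algebra: `a = cᴴ * c` for some `c`. -/
def MatPos {R : Type} [NonUnitalRing R] [StarRing R] {ι : Type} [Fintype ι]
    (a : Matrix ι ι R) : Prop :=
  ∃ c : Matrix ι ι R, a = cᴴ * c

/-- The `k`-fold direct sum `a ⊕ ⋯ ⊕ a`, representing `k⟨a⟩` in the Cuntz semigroup. -/
def matRep {R : Type} [NonUnitalRing R] {ι : Type} (k : ℕ) (a : Matrix ι ι R) :
    Matrix (ι × Fin k) (ι × Fin k) R :=
  Matrix.blockDiagonal fun _ : Fin k => a

/-- `β`-comparison in the sense of Kirchberg–Rørdam. -/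
def BetaComparison (R : Type) [NonUnitalRing R] [StarRing R] [TopologicalSpace R] (β : ℝ) : Prop :=
  ∀ (n m k l : ℕ), 1 ≤ k → 1 ≤ l → β * (l : ℝ) < (k : ℝ) →
    ∀ (a : Matrix (Fin n) (Fin n) R) (b : Matrix (Fin m) (Fin m) R),
      MatPos a → MatPos b → MatCuntzLE (matRep k a) (matRep l b) → MatCuntzLE a b

/-- `n`-comparison in the sense of Winter. -/
def NComparison (R : Type) [NonUnitalRing R] [StarRing R] [TopologicalSpace R] (N : ℕ) : Prop :=
  ∀ (na : ℕ) (mb : Fin (N + 1) → ℕ)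
    (a : Matrix (Fin na) (Fin na) R) (b : ∀ j, Matrix (Fin (mb j)) (Fin (mb j)) R),
    MatPos a → (∀ j, MatPos (b j)) →
    (∀ j, ∃ k : ℕ, 1 ≤ k ∧ MatCuntzLE (matRep (k + 1) a) (matRep k (b j))) →
    MatCuntzLE a (Matrix.blockDiagonal' b)

/-- Almost unperforation of the Cuntz semigroup `W(R)`. -/
def AlmostUnperforatedW (R : Type) [NonUnitalRing R] [StarRing R] [TopologicalSpace R] : Prop :=
  ∀ (n m : ℕ) (a : Matrix (Fin n) (Fin n) R) (b : Matrix (Fin m) (Fin m) R),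
    MatPos a → MatPos b →
    ∀ k : ℕ, 1 ≤ k → MatCuntzLE (matRep (k + 1) a) (matRep k b) → MatCuntzLE a b

/-- Stable finiteness: every isometry in every matrix algebra is a unitary. -/
def StablyFinite (R : Type) [Ring R] [StarRing R] : Prop :=
  ∀ (n : ℕ) (v : Matrix (Fin n) (Fin n) R), vᴴ * v = 1 → v * vᴴ = 1

/-- The hereditary corner `pAp` of a C*-algebra, as a non-unital star subalgebra. -/
def cstarCorner {A : Type} [CStarAlgebra A] (p : A)
    (hp : IsIdempotentElem p) (hps : IsSelfAdjoint p) : NonUnitalStarSubalgebra ℂ A where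
  carrier := {x | p * x * p = x}
  add_mem' := by
    intro x y hx hy
    simp only [Set.mem_setOf_eq] at *
    rw [mul_add, add_mul, hx, hy]
  zero_mem' := by simp
  mul_mem' := by
    intro x y hx hy
    simp only [Set.mem_setOf_eq] at *
    have hpx : p * x = x := by
      conv_lhs => rw [← hx]
      rw [← mul_assoc, ← mul_assoc, hp.eq]
      exact hx
    have hyp : y * p = y := by
      conv_lhs => rw [← hy]
      rw [mul_assoc, hp.eq]
      exact hy
    calc p * (x * y) * p = (p * x) * (y * p) := by rw [mul_assoc, mul_assoc, mul_assoc]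
    _ = x * y := by rw [hpx, hyp]
  smul_mem' := by
    intro c x hx
    simp only [Set.mem_setOf_eq] at *
    rw [mul_smul_comm, smul_mul_assoc, hx]
  star_mem' := by
    intro x hx
    simp only [Set.mem_setOf_eq] at *
    conv_rhs => rw [← hx]
    simp [StarMul.star_mul, hps.star_eq, mul_assoc]

section CornerAux

variable {A : Type} [CStarAlgebra A] {p : A} {hp : IsIdempotentElem p} {hps : IsSelfAdjoint p}

theorem corner_map_mul {ι κ μ : Type} [Fintype κ]
    (X : Matrix ι κ (cstarCorner p hp hps)) (Y : Matrix κ μ (cstarCorner p hp hps)) :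
    (X * Y).map (Subtype.val : _ → A) = X.map Subtype.val * Y.map Subtype.val := by
  ext i j
  simp only [Matrix.map_apply, Matrix.mul_apply]
  exact map_sum (NonUnitalStarSubalgebraClass.subtype (cstarCorner p hp hps)) _ _

theorem corner_map_star {ι κ : Type}
    (X : Matrix ι κ (cstarCorner p hp hps)) :
    (Xᴴ).map (Subtype.val : _ → A) = (X.map Subtype.val)ᴴ := by
  ext i j
  rfl

theorem corner_matRep {ι : Type} (k : ℕ)
    (X : Matrix ι ι (cstarCorner p hp hps)) :
    (matRep k X).map (Subtype.val : _ → A) = matRep k (X.map Subtype.val) := by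
  unfold matRep
  exact Matrix.blockDiagonal_map _ _ rfl

theorem corner_matPos {ι : Type} [Fintype ι] {X : Matrix ι ι (cstarCorner p hp hps)}
    (h : MatPos X) : MatPos (X.map (Subtype.val : _ → A)) := by
  obtain ⟨c, rfl⟩ := h
  exact ⟨c.map Subtype.val, by rw [corner_map_mul, corner_map_star]⟩

theorem corner_cuntz {ι κ : Type} [Fintype ι] [Fintype κ]
    {X : Matrix ι ι (cstarCorner p hp hps)} {Y : Matrix κ κ (cstarCorner p hp hps)}
    (h : MatCuntzLE X Y) :
    MatCuntzLE (X.map (Subtype.val : _ → A)) (Y.map (Subtype.val : _ → A)) := by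
  obtain ⟨v, hv⟩ := h
  refine ⟨fun k => (v k).map Subtype.val, ?_⟩
  have hc : Continuous (fun M : Matrix ι ι (cstarCorner p hp hps) =>
      M.map (Subtype.val : _ → A)) := continuous_id.matrix_map continuous_subtype_val
  have := (hc.tendsto X).comp hv
  refine this.congr fun k => ?_
  simp only [Function.comp, corner_map_mul, corner_map_star]

/-- Compression onto the corner. -/
def cornerCompress (p : A) (hp : IsIdempotentElem p) (hps : IsSelfAdjoint p) (x : A) :
    cstarCorner p hp hps :=
  ⟨p * x * p, by
    change p * (p * x * p) * p = p * x * p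
    rw [mul_assoc p x p, ← mul_assoc p p, hp.eq, mul_assoc, mul_assoc x, hp.eq]⟩

theorem corner_compress_val {ι κ : Type} [Fintype ι] [Fintype κ] [DecidableEq ι] [DecidableEq κ]
    (V : Matrix ι κ A) :
    (V.map (cornerCompress p hp hps)).map (Subtype.val : _ → A)
      = (Matrix.diagonal (fun _ => p) : Matrix ι ι A) * V * (Matrix.diagonal (fun _ => p) : Matrix κ κ A) := by
  ext i j
  simp [cornerCompress]

theorem corner_fix (x : cstarCorner p hp hps) : p * (x : A) * p = x := x.2

theorem corner_cuntz_of {ι κ : Type} [Fintype ι] [Fintype κ]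
    {X : Matrix ι ι (cstarCorner p hp hps)} {Y : Matrix κ κ (cstarCorner p hp hps)}
    (h : MatCuntzLE (X.map (Subtype.val : _ → A)) (Y.map (Subtype.val : _ → A))) :
    MatCuntzLE X Y := by
  classical
  obtain ⟨v, hv⟩ := h
  refine ⟨fun k => (v k).map (cornerCompress p hp hps), ?_⟩
  have hcc : Continuous (cornerCompress p hp hps) := by
    unfold cornerCompress
    fun_prop
  have hc : Continuous (fun M : Matrix ι ι A => M.map (cornerCompress p hp hps)) :=
    continuous_id.matrix_map hcc
  have hX : (X.map (Subtype.val : _ → A)).map (cornerCompress p hp hps) = X := by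
    ext i j
    exact corner_fix (X i j)
  have hY : Matrix.diagonal (fun _ => p) * Y.map (Subtype.val : _ → A)
      * Matrix.diagonal (fun _ => p) = Y.map Subtype.val := by
    ext i j
    simp [corner_fix]
  have h2 := (hc.tendsto (X.map (Subtype.val : _ → A))).comp hv
  rw [hX] at h2
  refine h2.congr fun k => ?_
  apply Matrix.map_injective Subtype.val_injective
  simp only [Function.comp]
  rw [corner_map_mul, corner_map_mul, corner_map_star, corner_compress_val, corner_compress_val]
  conv_lhs => rw [← hY]
  have hst : star (fun _ : κ => p) = fun _ => p := funext fun _ => hps.star_eq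
  have hst' : star (fun _ : ι => p) = fun _ => p := funext fun _ => hps.star_eq
  simp only [Matrix.conjTranspose_mul, Matrix.diagonal_conjTranspose, hst, hst', Matrix.mul_assoc]

end CornerAux

/-- If a unital C*-algebra `A` has `n`-comparison (in the sense of Winter) for some integer
`n ≥ 0` and `p ∈ A` is a nonzero projection, then the unital hereditary C*-subalgebra `pAp`
has `n`-comparison. -/
theorem nComparison_corner
    (A : Type) [CStarAlgebra A] (n : ℕ)
    (hA : NComparison A n)
    (p : A) (hp : IsIdempotentElem p) (hps : IsSelfAdjoint p) (hp0 : p ≠ 0) :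
    NComparison (cstarCorner p hp hps) n := by
  intro na mb a b ha hb hab
  apply corner_cuntz_of
  rw [Matrix.blockDiagonal'_map _ _ rfl]
  refine hA na mb _ _ (corner_matPos ha) (fun j => corner_matPos (hb j)) fun j => ?_
  obtain ⟨k, hk, h⟩ := hab j
  refine ⟨k, hk, ?_⟩
  rw [← corner_matRep, ← corner_matRep]
  exact corner_cuntz h
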